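/- Let U ⊆ ℝ^m be open, let ω be a smooth nondegenerate closed 2-form on U with components ω_{ij}, and let Γ^l_{ij} : U → ℝ be the Christoffel symbols of a symplectic connection for ω, i.e. Γ^l_{ij} = Γ^l_{ji} and ∂_k ω_{ij} = ω_{il} Γ^l_{kj} − ω_{jl} Γ^l_{ki} for all i,j,k. Define the curvature components R^l_{ijk} := ∂_j Γ^l_{ki} − ∂_k Γ^l_{ij} + Γ^m_{ki} Γ^l_{jm} − Γ^m_{ij} Γ^l_{km} (summation over m), and the lowered curvature tensor R_{ijkl} := ω_{im} R^m_{jkl} (summation over m). Then R_{ijkl} = R_{jikl} for all indices i,j,k,l, i.e. the lowered curvature tensor of a symplectic connection is symmetric in its first two indices. -/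

import Mathlib

open scoped BigOperators

/-- Partial derivative of `f : ℝ^m → ℝ` in the `k`-th coordinate direction at `x`. -/
noncomputable def pd {m : ℕ} (k : Fin m) (f : (Fin m → ℝ) → ℝ) (x : Fin m → ℝ) : ℝ :=
  fderiv ℝ f x (Pi.single k 1)

/-- Partial derivatives of a `C²` function commute. -/
lemma pd_comm {m : ℕ} {f : (Fin m → ℝ) → ℝ} {x : Fin m → ℝ} (hf : ContDiffAt ℝ 2 f x)
    (k l : Fin m) : pd k (pd l f) x = pd l (pd k f) x := by
  have hd : DifferentiableAt ℝ (fderiv ℝ f) x :=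
    (hf.fderiv_right (m := 1) (by norm_num)).differentiableAt (by norm_num)
  have key (a b : Fin m) :
      pd a (pd b f) x = fderiv ℝ (fderiv ℝ f) x (Pi.single a 1) (Pi.single b 1) := by
    change fderiv ℝ (fun y => fderiv ℝ f y (Pi.single b 1)) x (Pi.single a 1) = _
    rw [fderiv_clm_apply hd (differentiableAt_const _)]
    simp
  rw [key, key]
  exact (hf.isSymmSndFDerivAt (by simp)) _ _

lemma pd_congr {m : ℕ} {f g : (Fin m → ℝ) → ℝ} {U : Set (Fin m → ℝ)} (hU : IsOpen U)
    (h : ∀ y ∈ U, f y = g y) (k : Fin m) {x : Fin m → ℝ} (hx : x ∈ U) :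
    pd k f x = pd k g x := by
  rw [pd, pd, Filter.EventuallyEq.fderiv_eq (Filter.eventuallyEq_of_mem (hU.mem_nhds hx) h)]

/-- Leibniz rule for `pd` on a sum of differences of products. -/
lemma pd_sum_mul_sub_mul {m : ℕ} {ι : Type*} [Fintype ι] {a b c d : ι → (Fin m → ℝ) → ℝ}
    {x : Fin m → ℝ} (ha : ∀ l, DifferentiableAt ℝ (a l) x) (hb : ∀ l, DifferentiableAt ℝ (b l) x)
    (hc : ∀ l, DifferentiableAt ℝ (c l) x) (hd : ∀ l, DifferentiableAt ℝ (d l) x) (k : Fin m) :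
    pd k (fun y => ∑ l, (a l y * b l y - c l y * d l y)) x =
      ∑ l, ((a l x * pd k (b l) x + b l x * pd k (a l) x) -
        (c l x * pd k (d l) x + d l x * pd k (c l) x)) := by
  have h := HasFDerivAt.fun_sum (u := Finset.univ) fun l _ =>
    ((ha l).hasFDerivAt.mul (hb l).hasFDerivAt).sub ((hc l).hasFDerivAt.mul (hd l).hasFDerivAt)
  have h' : pd k (fun y => ∑ l, (a l y * b l y - c l y * d l y)) x = _ :=
    congrArg (fun L => L (Pi.single k 1)) h.fderiv
  rw [h']
  simp [pd]

/-- The part of `∂_c ∂_d ω_{ij}` that is not symmetric in `c`, `d`, in terms of the connection: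
here `w`, `G`, `D c l i j` stand for `ω`, `Γ` and `∂_c Γ^l_{ij}` at a point. -/
lemma sum_lowered_curvature_sub {ι : Type*} [Fintype ι] (w : ι → ι → ℝ)
    (hw : ∀ i j, w i j = -w j i) (G : ι → ι → ι → ℝ) (D : ι → ι → ι → ι → ℝ) (i j c d : ι) :
    (∑ l, ((w i l * D c l d j + G l d j * ∑ n, (w i n * G n c l - w l n * G n c i)) -
        (w j l * D c l d i + G l d i * ∑ n, (w j n * G n c l - w l n * G n c j)))) -
      (∑ l, ((w i l * D d l c j + G l c j * ∑ n, (w i n * G n d l - w l n * G n d i)) -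
        (w j l * D d l c i + G l c i * ∑ n, (w j n * G n d l - w l n * G n d j)))) =
    (∑ p, w i p * (D c p d j - D d p c j + ∑ n, (G n d j * G p c n - G n c j * G p d n))) -
      ∑ p, w j p * (D c p d i - D d p c i + ∑ n, (G n d i * G p c n - G n c i * G p d n)) := by
  have swap (a b e f : ι) : ∑ l, ∑ n, w a n * G n b l * G l e f =
      ∑ p, ∑ n, w a p * (G n e f * G p b n) := by
    rw [Finset.sum_comm]
    exact Finset.sum_congr rfl fun _ _ => Finset.sum_congr rfl fun _ _ => by ring
  have cross (a b e f : ι) : ∑ l, ∑ n, w l n * G n a b * G l e f =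
      -∑ l, ∑ n, w l n * G n e f * G l a b := by
    rw [Finset.sum_comm, ← Finset.sum_neg_distrib]
    refine Finset.sum_congr rfl fun l _ => ?_
    rw [← Finset.sum_neg_distrib]
    exact Finset.sum_congr rfl fun n _ => by rw [hw n l]; ring
  have expand (a b e f : ι) : ∑ l, G l e f * ∑ n, (w a n * G n b l - w l n * G n b a) =
      (∑ p, ∑ n, w a p * (G n e f * G p b n)) - ∑ l, ∑ n, w l n * G n b a * G l e f := by
    rw [← swap, ← Finset.sum_sub_distrib]
    refine Finset.sum_congr rfl fun l _ => ?_
    rw [Finset.mul_sum, ← Finset.sum_sub_distrib]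
    exact Finset.sum_congr rfl fun n _ => by ring
  simp only [Finset.mul_sum, Finset.sum_sub_distrib, Finset.sum_add_distrib, mul_add, mul_sub]
    at expand ⊢
  linarith [cross c i d j, cross d i c j, expand i c d j, expand j c d i, expand i d c j,
    expand j d c i]

/-- the lowered curvature tensor `R_{ijkl} = ω_{im} R^m_{jkl}` of a
symplectic connection (symmetric Christoffel symbols `Γ^l_{ij}` preserving a smooth
nondegenerate closed 2-form `ω`) is symmetric in its first two indices:
`R_{ijkl} = R_{jikl}`. -/
theorem lowered_curvature_symmetric_first_two
    (m : ℕ) (U : Set (Fin m → ℝ)) (hU : IsOpen U)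
    (ω : Fin m → Fin m → (Fin m → ℝ) → ℝ)
    (hωsmooth : ∀ i j, ContDiffOn ℝ (⊤ : ℕ∞) (ω i j) U)
    (hωanti : ∀ x ∈ U, ∀ i j, ω i j x = - ω j i x)
    (hωnondeg : ∀ x ∈ U, (Matrix.of fun i j => ω i j x).det ≠ 0)
    (hωclosed : ∀ x ∈ U, ∀ i j k,
      pd k (ω i j) x + pd i (ω j k) x + pd j (ω k i) x = 0)
    (Γ : Fin m → Fin m → Fin m → (Fin m → ℝ) → ℝ)
    (hΓsmooth : ∀ l i j, ContDiffOn ℝ (⊤ : ℕ∞) (Γ l i j) U)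
    (hΓsym : ∀ l i j, ∀ x ∈ U, Γ l i j x = Γ l j i x)
    (hpres : ∀ x ∈ U, ∀ i j k,
      pd k (ω i j) x = ∑ l, (ω i l x * Γ l k j x - ω j l x * Γ l k i x))
    (R : Fin m → Fin m → Fin m → Fin m → (Fin m → ℝ) → ℝ)
    (hRdef : ∀ l i j k x, R l i j k x =
      pd j (Γ l k i) x - pd k (Γ l i j) x +
      ∑ m', (Γ m' k i x * Γ l j m' x - Γ m' i j x * Γ l k m' x)) :
    ∀ x ∈ U, ∀ i j k l,
      (∑ m', ω i m' x * R m' j k l x) = ∑ m', ω j m' x * R m' i k l x := by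
  intro x hx i j c d
  have hnhds {y : Fin m → ℝ} (hy : y ∈ U) : U ∈ nhds y := hU.mem_nhds hy
  have hωd (a b) : DifferentiableAt ℝ (ω a b) x :=
    ((hωsmooth a b).contDiffAt (hnhds hx)).differentiableAt (by simp)
  have hΓd (a b e) : DifferentiableAt ℝ (Γ a b e) x :=
    ((hΓsmooth a b e).contDiffAt (hnhds hx)).differentiableAt (by simp)
  have hsnd (a b : Fin m) : pd a (pd b (ω i j)) x =
      ∑ l, ((ω i l x * pd a (Γ l b j) x +
          Γ l b j x * ∑ n, (ω i n x * Γ n a l x - ω l n x * Γ n a i x)) -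
        (ω j l x * pd a (Γ l b i) x +
          Γ l b i x * ∑ n, (ω j n x * Γ n a l x - ω l n x * Γ n a j x))) := by
    rw [pd_congr hU (fun y hy => hpres y hy i j b) a hx,
      pd_sum_mul_sub_mul (fun l => hωd i l) (fun l => hΓd l b j) (fun l => hωd j l)
        (fun l => hΓd l b i)]
    simp only [hpres x hx]
  have hcomm := pd_comm (((hωsmooth i j).contDiffAt (hnhds hx)).of_le
    (WithTop.coe_le_coe.mpr (le_top : (2 : ℕ∞) ≤ ⊤))) c d
  have hR (p a : Fin m) : R p a c d x = pd c (Γ p d a) x - pd d (Γ p c a) x +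
      ∑ n, (Γ n d a x * Γ p c n x - Γ n c a x * Γ p d n x) := by
    rw [hRdef, pd_congr hU (fun y hy => hΓsym p a c y hy) d hx]
    simp only [hΓsym _ a c x hx]
  have key := sum_lowered_curvature_sub (fun a b => ω a b x) (hωanti x hx)
    (fun l a b => Γ l a b x) (fun e l a b => pd e (Γ l a b) x) i j c d
  rw [← hsnd c d, ← hsnd d c, hcomm, sub_self] at key
  simp only [hR]
  exact sub_eq_zero.mp key.symm
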